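/- arXiv:2209.08553 — 2 statements merged into one kernel-verified Lean document; each statement's English description precedes it below -/
import Mathlib

section
/- Let A be an n×n complex matrix. If there exists some p₀ ∈ (1,∞) such that ‖A‖_{p₀,p₀} = ‖A‖_{1,1}^{1/p₀} · ‖A‖_{∞,∞}^{1 − 1/p₀}, then A is logarithmic affine, i.e. ‖A‖_{p,p} = ‖A‖_{1,1}^{1/p} · ‖A‖_{∞,∞}^{1 − 1/p} for every p ∈ [1,∞] (with 1/∞ = 0). -/
open scoped BigOperators ENNReal
open Matrix

/-- The `ℓ^p` norm of a finitely-indexed vector (with the convention `1/∞ = 0`). -/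
noncomputable def lpNorm {ι : Type*} [Fintype ι] {E : Type*} [Norm E] (p : ℝ≥0∞)
    (x : ι → E) : ℝ :=
  if p = ∞ then ⨆ i, ‖x i‖ else (∑ i, ‖x i‖ ^ p.toReal) ^ p.toReal⁻¹

/-- The operator norm of a square complex matrix acting on `ℓ^p`. -/
noncomputable def opNorm {ι : Type*} [Fintype ι] (p : ℝ≥0∞) (A : Matrix ι ι ℂ) : ℝ :=
  sSup {r : ℝ | ∃ x : ι → ℂ, lpNorm p x = 1 ∧ r = lpNorm p (A.mulVec x)}

/-- A unitary permutation matrix: a permutation matrix whose nonzero entries are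
unimodular complex numbers. -/
def IsUnitaryPermutation {n : ℕ} (S : Matrix (Fin n) (Fin n) ℂ) : Prop :=
  ∃ (σ : Equiv.Perm (Fin n)) (α : Fin n → ℂ), (∀ i, ‖α i‖ = 1) ∧
    ∀ i j, S i j = if j = σ i then α i else 0

/-- `A` is logarithmic affine: `‖A‖_{p,p} = ‖A‖_{1,1}^{1/p} ‖A‖_{∞,∞}^{1-1/p}` for all
`p ∈ [1,∞]` (with `1/∞ = 0`). -/
def LogAffine {ι : Type*} [Fintype ι] (A : Matrix ι ι ℂ) : Prop :=
  ∀ p : ℝ≥0∞, 1 ≤ p →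
    opNorm p A = opNorm 1 A ^ p.toReal⁻¹ * opNorm ⊤ A ^ (1 - p.toReal⁻¹)

/-- The circulant matrix `C(α₀,…,α_{n-1})`, whose `(i,j)` entry is `α_{j-i mod n}`. -/
noncomputable def circulantC {n : ℕ} (α : Fin n → ℂ) : Matrix (Fin n) (Fin n) ℂ :=
  Matrix.of fun i j => α (j - i)

/-- The Hankel-type matrix `H(α₀,…,α_{n-1})`, whose `(i,j)` entry is `α_{i+j mod n}`. -/
noncomputable def hankelH {n : ℕ} (α : Fin n → ℂ) : Matrix (Fin n) (Fin n) ℂ :=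
  Matrix.of fun i j => α (i + j)

theorem rpow_sum_mul_le {ι : Type*} [Fintype ι] {r : ℝ} (hr : 1 ≤ r) {w f : ι → ℝ}
    (hw : ∀ i, 0 ≤ w i) (hf : ∀ i, 0 ≤ f i) :
    (∑ i, w i * f i) ^ r ≤ (∑ i, w i) ^ (r - 1) * ∑ i, w i * f i ^ r := by
  have h0 : 0 ≤ ∑ i, w i := Finset.sum_nonneg fun i _ => hw i
  have h1 : 0 ≤ ∑ i, w i * f i := Finset.sum_nonneg fun i _ => mul_nonneg (hw i) (hf i)
  have h2 : 0 ≤ ∑ i, w i * f i ^ r :=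
    Finset.sum_nonneg fun i _ => mul_nonneg (hw i) (Real.rpow_nonneg (hf i) r)
  have hr0 : r ≠ 0 := by positivity
  refine (Real.rpow_le_rpow h1 (Real.inner_le_weight_mul_Lp_of_nonneg Finset.univ hr w f hw hf)
    (by positivity)).trans_eq ?_
  rw [Real.mul_rpow (by positivity) (by positivity), ← Real.rpow_mul h0, ← Real.rpow_mul h2,
    inv_mul_cancel₀ hr0, Real.rpow_one, sub_mul, inv_mul_cancel₀ hr0, one_mul]

theorem eq_of_rpow_sum_mul_eq {ι : Type*} [Fintype ι] {r M s : ℝ} (hr : 1 < r) {w f : ι → ℝ}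
    (hw : ∀ i, 0 ≤ w i) (hf : ∀ i, 0 ≤ f i) (hM : ∑ i, w i ≤ M) (hs : 0 ≤ s)
    (hsw : s ≤ ∑ i, w i * f i) (hpos : 0 < ∑ i, w i * f i ^ r)
    (h : M ^ (r - 1) * ∑ i, w i * f i ^ r ≤ s ^ r) :
    ∑ i, w i = M ∧ ∀ j, w j ≠ 0 → s = M * f j := by
  have hW0 : 0 ≤ ∑ i, w i := Finset.sum_nonneg fun i _ => hw i
  have h1 : 0 ≤ ∑ i, w i * f i := hs.trans hsw
  have hW : 0 < ∑ i, w i := by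
    refine hW0.lt_of_ne fun h0 => hpos.ne' ?_
    have := (Finset.sum_eq_zero_iff_of_nonneg fun i _ => hw i).1 h0.symm
    exact Finset.sum_eq_zero fun i hi => by rw [this i hi, zero_mul]
  have hjen := rpow_sum_mul_le hr.le hw hf
  have hsr : s ^ r ≤ (∑ i, w i * f i) ^ r := Real.rpow_le_rpow hs hsw (by linarith)
  have hWM : ∑ i, w i = M := by
    refine le_antisymm hM ((Real.rpow_le_rpow_iff (hW0.trans hM) hW0 (sub_pos.2 hr)).1 ?_)
    exact le_of_mul_le_mul_right (h.trans (hsr.trans hjen)) hpos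
  have hs' : s = ∑ i, w i * f i := by
    refine le_antisymm hsw ((Real.rpow_le_rpow_iff h1 hs (zero_lt_one.trans hr)).1 ?_)
    rw [hWM] at hjen
    exact hjen.trans h
  refine ⟨hWM, fun j hj => ?_⟩
  subst hWM
  have key := (StrictConvexOn.map_sum_eq_iff' (strictConvexOn_rpow hr) (t := Finset.univ)
    (w := fun i => w i / ∑ i, w i) (p := f) (fun i _ => div_nonneg (hw i) hW0)
    (by rw [← Finset.sum_div, div_self hW.ne']) (fun i _ => hf i)).1 ?_ j (Finset.mem_univ j)
    (div_ne_zero hj hW.ne')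
  · simp only [smul_eq_mul, div_mul_eq_mul_div] at key
    rw [← Finset.sum_div, ← hs'] at key
    rw [key]
    field_simp
  · simp only [smul_eq_mul, div_mul_eq_mul_div]
    rw [← Finset.sum_div, ← Finset.sum_div, Real.div_rpow h1 hW0,
      div_eq_div_iff (by positivity) hW.ne']
    have e : (∑ i, w i * f i) ^ r = (∑ i, w i) ^ (r - 1) * ∑ i, w i * f i ^ r :=
      le_antisymm hjen (h.trans hsr)
    rw [e, Real.rpow_sub_one hW.ne']
    field_simp

section

variable {n : ℕ}

theorem norm_mulVec_le (A : Matrix (Fin n) (Fin n) ℂ) (x : Fin n → ℂ) (i : Fin n) :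
    ‖(A *ᵥ x) i‖ ≤ ∑ j, ‖A i j‖ * ‖x j‖ := by
  simp only [mulVec, dotProduct, ← norm_mul]
  exact norm_sum_le _ _

theorem norm_mulVec_rpow_le {A : Matrix (Fin n) (Fin n) ℂ} {M r : ℝ} (hr : 1 ≤ r)
    (hM : ∀ i, ∑ j, ‖A i j‖ ≤ M) (x : Fin n → ℂ) (i : Fin n) :
    ‖(A *ᵥ x) i‖ ^ r ≤ M ^ (r - 1) * ∑ j, ‖A i j‖ * ‖x j‖ ^ r := by
  refine (Real.rpow_le_rpow (norm_nonneg _) (norm_mulVec_le A x i) (by linarith)).trans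
    ((rpow_sum_mul_le hr (fun _ => norm_nonneg _) fun _ => norm_nonneg _).trans ?_)
  gcongr
  exact hM i

theorem sum_row_weighted (A : Matrix (Fin n) (Fin n) ℂ) (g : Fin n → ℝ) :
    ∑ i, ∑ j, ‖A i j‖ * g j = ∑ j, (∑ i, ‖A i j‖) * g j := by
  rw [Finset.sum_comm]
  exact Finset.sum_congr rfl fun _ _ => (Finset.sum_mul _ _ _).symm

theorem sum_norm_mulVec_rpow_le {A : Matrix (Fin n) (Fin n) ℂ} {M N r : ℝ} (hr : 1 ≤ r)
    (hM0 : 0 ≤ M) (hM : ∀ i, ∑ j, ‖A i j‖ ≤ M) (hN : ∀ j, ∑ i, ‖A i j‖ ≤ N)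
    (x : Fin n → ℂ) :
    ∑ i, ‖(A *ᵥ x) i‖ ^ r ≤ M ^ (r - 1) * N * ∑ j, ‖x j‖ ^ r := by
  refine (Finset.sum_le_sum fun i _ => norm_mulVec_rpow_le hr hM x i).trans ?_
  rw [← Finset.mul_sum, sum_row_weighted, mul_assoc, Finset.mul_sum Finset.univ _ N]
  gcongr
  exact hN _

theorem lpNorm_nonneg {ι : Type*} [Fintype ι] (p : ℝ≥0∞) (x : ι → ℂ) : 0 ≤ lpNorm p x := by
  unfold lpNorm
  split_ifs
  · exact Real.iSup_nonneg fun _ => norm_nonneg _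
  · positivity

theorem lpNorm_of_ne_top {ι : Type*} [Fintype ι] {p : ℝ≥0∞} (hp : p ≠ ⊤) (x : ι → ℂ) :
    lpNorm p x = (∑ i, ‖x i‖ ^ p.toReal) ^ p.toReal⁻¹ := if_neg hp

theorem lpNorm_top {ι : Type*} [Fintype ι] (x : ι → ℂ) : lpNorm ⊤ x = ⨆ i, ‖x i‖ := if_pos rfl

theorem lpNorm_eq_one_iff {ι : Type*} [Fintype ι] {p : ℝ≥0∞} (hp : 1 ≤ p) (hp' : p ≠ ⊤)
    (x : ι → ℂ) : lpNorm p x = 1 ↔ ∑ i, ‖x i‖ ^ p.toReal = 1 := by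
  have : 0 < p.toReal := ENNReal.toReal_pos (by positivity) hp'
  rw [lpNorm_of_ne_top hp', Real.rpow_inv_eq (by positivity) zero_le_one this.ne', Real.one_rpow]

theorem opNorm_nonneg (p : ℝ≥0∞) (A : Matrix (Fin n) (Fin n) ℂ) : 0 ≤ opNorm p A := by
  refine Real.sSup_nonneg ?_
  rintro _ ⟨x, -, rfl⟩
  exact lpNorm_nonneg _ _

theorem lpNorm_mulVec_le {A : Matrix (Fin n) (Fin n) ℂ} {M N : ℝ} {p : ℝ≥0∞} (hp : 1 ≤ p)
    (hp' : p ≠ ⊤) (hM0 : 0 ≤ M) (hM : ∀ i, ∑ j, ‖A i j‖ ≤ M)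
    (hN : ∀ j, ∑ i, ‖A i j‖ ≤ N) {x : Fin n → ℂ} (hx : lpNorm p x = 1) :
    lpNorm p (A *ᵥ x) ≤ (M ^ (p.toReal - 1) * N) ^ p.toReal⁻¹ := by
  have h1 : 1 ≤ p.toReal := by
    simpa using (ENNReal.toReal_le_toReal ENNReal.one_ne_top hp').2 hp
  rw [lpNorm_of_ne_top hp']
  rw [lpNorm_eq_one_iff hp hp'] at hx
  have := sum_norm_mulVec_rpow_le h1 hM0 hM hN x
  rw [hx, mul_one] at this
  gcongr

theorem norm_le_sum_norm (A : Matrix (Fin n) (Fin n) ℂ) :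
    (∀ i, ∑ j, ‖A i j‖ ≤ ∑ i, ∑ j, ‖A i j‖) ∧ ∀ j, ∑ i, ‖A i j‖ ≤ ∑ i, ∑ j, ‖A i j‖ := by
  refine ⟨fun i => Finset.single_le_sum (f := fun i => ∑ j, ‖A i j‖)
    (fun i _ => by positivity) (Finset.mem_univ i), fun j => ?_⟩
  rw [Finset.sum_comm]
  exact Finset.single_le_sum (f := fun j => ∑ i, ‖A i j‖)
    (fun i _ => by positivity) (Finset.mem_univ j)

theorem lpNorm_mulVec_le_opNorm {p : ℝ≥0∞} (hp : 1 ≤ p) (A : Matrix (Fin n) (Fin n) ℂ)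
    {x : Fin n → ℂ} (hx : lpNorm p x = 1) : lpNorm p (A *ᵥ x) ≤ opNorm p A := by
  refine le_csSup ?_ ⟨x, hx, rfl⟩
  obtain ⟨hM, hN⟩ := norm_le_sum_norm A
  by_cases hp' : p = ⊤
  · subst hp'
    refine ⟨∑ i, ∑ j, ‖A i j‖, ?_⟩
    rintro _ ⟨y, hy, rfl⟩
    rw [lpNorm_top] at hy ⊢
    refine Real.iSup_le (fun i => ?_) (by positivity)
    refine (norm_mulVec_le A y i).trans (le_trans (Finset.sum_le_sum fun j _ => ?_) (hM i))
    exact mul_le_of_le_one_right (norm_nonneg _)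
      (hy ▸ le_ciSup (f := fun i => ‖y i‖) (Set.finite_range _).bddAbove j)
  · refine ⟨((∑ i, ∑ j, ‖A i j‖) ^ (p.toReal - 1) * ∑ i, ∑ j, ‖A i j‖) ^ p.toReal⁻¹, ?_⟩
    rintro _ ⟨y, hy, rfl⟩
    exact lpNorm_mulVec_le hp hp' (by positivity) hM hN hy

theorem sum_norm_row_le_opNorm_top (A : Matrix (Fin n) (Fin n) ℂ) (i : Fin n) :
    ∑ j, ‖A i j‖ ≤ opNorm ⊤ A := by
  have hu : ∀ a : ℂ, ∃ u : ℂ, ‖u‖ = 1 ∧ a * u = ‖a‖ := fun a => by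
    by_cases ha : a = 0
    · exact ⟨1, by simp [ha]⟩
    · refine ⟨‖a‖ / a, ?_, ?_⟩
      · simp [ha]
      · field_simp
  choose u hu1 hu2 using hu
  have : Nonempty (Fin n) := ⟨i⟩
  have hx : lpNorm ⊤ (fun j => u (A i j)) = 1 := by simp [lpNorm_top, hu1]
  refine le_trans ?_ (lpNorm_mulVec_le_opNorm le_top A hx)
  rw [lpNorm_top]
  refine le_trans (le_of_eq ?_) (le_ciSup (f := fun k => ‖(A *ᵥ fun j => u (A i j)) k‖)
    (Set.finite_range _).bddAbove i)
  simp only [mulVec, dotProduct, hu2]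
  rw [← Complex.ofReal_sum, Complex.norm_real, Real.norm_of_nonneg (by positivity)]

theorem sum_norm_col_le_opNorm_one (A : Matrix (Fin n) (Fin n) ℂ) (j : Fin n) :
    ∑ i, ‖A i j‖ ≤ opNorm 1 A := by
  have hx : lpNorm 1 (Pi.single j 1 : Fin n → ℂ) = 1 := by
    rw [lpNorm_eq_one_iff le_rfl ENNReal.one_ne_top]
    simp [Pi.single_apply, apply_ite norm]
  refine le_trans (le_of_eq ?_) (lpNorm_mulVec_le_opNorm le_rfl A hx)
  simp [lpNorm_of_ne_top]

theorem opNorm_le {p : ℝ≥0∞} (hp : 1 ≤ p) (hp' : p ≠ ⊤) (A : Matrix (Fin n) (Fin n) ℂ) :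
    opNorm p A ≤ opNorm 1 A ^ p.toReal⁻¹ * opNorm ⊤ A ^ (1 - p.toReal⁻¹) := by
  have hM0 := opNorm_nonneg ⊤ A
  have hN0 := opNorm_nonneg 1 A
  have hr : p.toReal ≠ 0 := (ENNReal.toReal_pos (by positivity) hp').ne'
  refine Real.sSup_le ?_ (by positivity)
  rintro _ ⟨x, hx, rfl⟩
  refine (lpNorm_mulVec_le hp hp' hM0 (sum_norm_row_le_opNorm_top A)
    (sum_norm_col_le_opNorm_one A) hx).trans_eq ?_
  rw [Real.mul_rpow (by positivity) hN0, ← Real.rpow_mul hM0, sub_mul, mul_inv_cancel₀ hr,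
    one_mul, mul_comm]

theorem rpow_le_opNorm {p : ℝ≥0∞} (hp : 1 ≤ p) (hp' : p ≠ ⊤) {A : Matrix (Fin n) (Fin n) ℂ}
    {K : ℝ} {x : Fin n → ℂ} (hx : x ≠ 0)
    (h : ∑ i, ‖(A *ᵥ x) i‖ ^ p.toReal = K * ∑ i, ‖x i‖ ^ p.toReal) :
    K ^ p.toReal⁻¹ ≤ opNorm p A := by
  have hr : 0 < p.toReal := ENNReal.toReal_pos (by positivity) hp'
  set S := ∑ i, ‖x i‖ ^ p.toReal with hS
  have hSpos : 0 < S := by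
    obtain ⟨j, hj⟩ := Function.ne_iff.1 hx
    exact Finset.sum_pos' (fun i _ => by positivity)
      ⟨j, Finset.mem_univ j, Real.rpow_pos_of_pos (norm_pos_iff.2 hj) _⟩
  set t : ℝ := S⁻¹ ^ p.toReal⁻¹ with ht
  have ht0 : 0 ≤ t := by positivity
  have htr : t ^ p.toReal = S⁻¹ := Real.rpow_inv_rpow (by positivity) hr.ne'
  have hscale : ∀ y : Fin n → ℂ,
      ∑ i, ‖((t : ℂ) • y) i‖ ^ p.toReal = S⁻¹ * ∑ i, ‖y i‖ ^ p.toReal := fun y => by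
    rw [Finset.mul_sum]
    refine Finset.sum_congr rfl fun i _ => ?_
    rw [Pi.smul_apply, norm_smul, Complex.norm_real, Real.norm_of_nonneg ht0,
      Real.mul_rpow ht0 (norm_nonneg _), htr]
  have h1 : lpNorm p ((t : ℂ) • x) = 1 := by
    rw [lpNorm_eq_one_iff hp hp', hscale, ← hS, inv_mul_cancel₀ hSpos.ne']
  refine le_trans (le_of_eq ?_) (lpNorm_mulVec_le_opNorm hp A h1)
  rw [lpNorm_of_ne_top hp', mulVec_smul, hscale, h]
  congr 1
  field_simp

theorem exists_lpNorm_mulVec_eq_opNorm {p : ℝ≥0∞} (hp : 1 ≤ p) (hp' : p ≠ ⊤) [NeZero n]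
    (A : Matrix (Fin n) (Fin n) ℂ) :
    ∃ x : Fin n → ℂ, lpNorm p x = 1 ∧ lpNorm p (A *ᵥ x) = opNorm p A := by
  have hr : 0 < p.toReal := ENNReal.toReal_pos (by positivity) hp'
  have hcont : Continuous (lpNorm p : (Fin n → ℂ) → ℝ) := by
    rw [funext (lpNorm_of_ne_top hp' (ι := Fin n))]
    refine Continuous.rpow_const (continuous_finsetSum _ fun i _ => ?_)
      fun _ => Or.inr (by positivity)
    exact Continuous.rpow_const (by fun_prop) fun _ => Or.inr hr.le
  have hcompact : IsCompact {x : Fin n → ℂ | lpNorm p x = 1} := by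
    refine (isCompact_closedBall 0 1).of_isClosed_subset
      (isClosed_eq hcont continuous_const) fun x hx => ?_
    rw [mem_closedBall_zero_iff, pi_norm_le_iff_of_nonneg zero_le_one]
    intro i
    rw [Set.mem_ofPred_eq, lpNorm_eq_one_iff hp hp'] at hx
    refine (Real.rpow_le_rpow_iff (norm_nonneg _) zero_le_one hr).1 ?_
    rw [Real.one_rpow, ← hx]
    exact Finset.single_le_sum (f := fun i => ‖x i‖ ^ p.toReal) (fun i _ => by positivity)
      (Finset.mem_univ i)
  have hne : {x : Fin n → ℂ | lpNorm p x = 1}.Nonempty := by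
    refine ⟨Pi.single 0 1, ?_⟩
    rw [Set.mem_ofPred_eq, lpNorm_eq_one_iff hp hp']
    simp [Pi.single_apply, apply_ite norm, ite_pow, hr.ne']
  obtain ⟨x, hx, hmax⟩ := hcompact.exists_isMaxOn hne
    (f := fun x => lpNorm p (A *ᵥ x)) (by fun_prop)
  refine ⟨x, hx, le_antisymm (lpNorm_mulVec_le_opNorm hp A hx) ?_⟩
  refine Real.sSup_le ?_ (lpNorm_nonneg _ _)
  rintro _ ⟨y, hy, rfl⟩
  exact hmax hy

/-- If `x` attains equality in the interpolation inequality for one exponent, then the restriction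
of `x` to a nonzero level set of `‖x ·‖` attains it for every exponent. -/
theorem exists_forall_sum_norm_mulVec_rpow_eq {A : Matrix (Fin n) (Fin n) ℂ} {M N r : ℝ}
    (hr : 1 < r) (hM0 : 0 < M) (hM : ∀ i, ∑ j, ‖A i j‖ ≤ M) (hN : ∀ j, ∑ i, ‖A i j‖ ≤ N)
    {x : Fin n → ℂ} (hx : x ≠ 0)
    (h : M ^ (r - 1) * N * ∑ j, ‖x j‖ ^ r ≤ ∑ i, ‖(A *ᵥ x) i‖ ^ r) :
    ∃ y : Fin n → ℂ, y ≠ 0 ∧ ∀ s : ℝ, 0 < s →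
      ∑ i, ‖(A *ᵥ y) i‖ ^ s = M ^ (s - 1) * N * ∑ j, ‖y j‖ ^ s := by
  have hrow := fun i => norm_mulVec_rpow_le hr.le hM x i
  have hMr : 0 < M ^ (r - 1) := by positivity
  have hcol : ∀ j ∈ Finset.univ, (∑ i, ‖A i j‖) * ‖x j‖ ^ r ≤ N * ‖x j‖ ^ r := fun j _ => by
    gcongr
    exact hN j
  have hsum1 : ∑ i, ‖(A *ᵥ x) i‖ ^ r ≤ ∑ i, M ^ (r - 1) * ∑ j, ‖A i j‖ * ‖x j‖ ^ r :=
    Finset.sum_le_sum fun i _ => hrow i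
  have hsum2 := Finset.sum_le_sum hcol
  have heq : ∑ i, M ^ (r - 1) * ∑ j, ‖A i j‖ * ‖x j‖ ^ r
      = M ^ (r - 1) * ∑ j, (∑ i, ‖A i j‖) * ‖x j‖ ^ r := by
    rw [← Finset.mul_sum, sum_row_weighted]
  rw [mul_assoc, Finset.mul_sum] at h
  have hcol' := (Finset.sum_eq_sum_iff_of_le hcol).1 <| le_antisymm hsum2 <|
    le_of_mul_le_mul_left (h.trans (hsum1.trans_eq heq)) hMr
  have hrow' := (Finset.sum_eq_sum_iff_of_le fun i _ => hrow i).1 <| le_antisymm hsum1 <|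
    (heq.trans_le (mul_le_mul_of_nonneg_left hsum2 hMr.le)).trans h
  obtain ⟨k, hk⟩ := Function.ne_iff.1 hx
  have hk0 : 0 < ‖x k‖ := norm_pos_iff.2 hk
  set y : Fin n → ℂ := fun j => if ‖x j‖ = ‖x k‖ then x j else 0 with hy
  refine ⟨y, Function.ne_iff.2 ⟨k, by simpa [hy] using hk⟩, fun s hs => ?_⟩
  have hrowy : ∀ i, ‖(A *ᵥ y) i‖ ^ s = M ^ (s - 1) * ∑ j, ‖A i j‖ * ‖y j‖ ^ s := fun i => by
    by_cases hi : ∃ j, A i j ≠ 0 ∧ ‖x j‖ = ‖x k‖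
    · obtain ⟨j, hj, hjk⟩ := hi
      have hpos : 0 < ∑ j, ‖A i j‖ * ‖x j‖ ^ r :=
        Finset.sum_pos' (fun _ _ => by positivity) ⟨j, Finset.mem_univ j,
          mul_pos (norm_pos_iff.2 hj) (Real.rpow_pos_of_pos (hjk ▸ hk0) _)⟩
      obtain ⟨hW, hc⟩ := eq_of_rpow_sum_mul_eq hr (fun _ => norm_nonneg _)
        (fun _ => norm_nonneg _) (hM i) (norm_nonneg _) (norm_mulVec_le A x i) hpos
        (hrow' i (Finset.mem_univ i)).ge
      have hAx := hc j (norm_ne_zero_iff.2 hj)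
      have hlevel : ∀ l, A i l ≠ 0 → ‖x l‖ = ‖x k‖ := fun l hl => by
        have := hc l (norm_ne_zero_iff.2 hl)
        rw [← hjk]
        exact mul_left_cancel₀ hM0.ne' (this.symm.trans hAx)
      have hAy : (A *ᵥ y) i = (A *ᵥ x) i := by
        simp only [mulVec, dotProduct]
        refine Finset.sum_congr rfl fun l _ => ?_
        by_cases hl : A i l = 0
        · simp [hl]
        · simp [hy, hlevel l hl]
      have hT : ∑ j, ‖A i j‖ * ‖y j‖ ^ s = ∑ j, ‖A i j‖ * ‖x k‖ ^ s := by
        refine Finset.sum_congr rfl fun l _ => ?_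
        by_cases hl : A i l = 0
        · simp [hl]
        · simp [hy, hlevel l hl]
      rw [hT, ← Finset.sum_mul, hW, hAy, hAx, hjk, Real.mul_rpow hM0.le hk0.le,
        Real.rpow_sub_one hM0.ne']
      field_simp
    · push Not at hi
      have hzero : ∀ j, A i j = 0 ∨ y j = 0 := fun j => by
        by_cases hj : A i j = 0
        · exact Or.inl hj
        · exact Or.inr (if_neg (hi j hj))
      have hAy : (A *ᵥ y) i = 0 := by
        simp only [mulVec, dotProduct]
        exact Finset.sum_eq_zero fun j _ => mul_eq_zero.2 (hzero j)
      have hT : ∑ j, ‖A i j‖ * ‖y j‖ ^ s = 0 := Finset.sum_eq_zero fun j _ => by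
        rcases hzero j with hj | hj <;> simp [hj, hs.ne']
      rw [hAy, hT, norm_zero, Real.zero_rpow hs.ne', mul_zero]
  rw [Finset.sum_congr rfl fun i _ => hrowy i, ← Finset.mul_sum, sum_row_weighted, mul_assoc,
    Finset.mul_sum Finset.univ _ N]
  congr 1
  refine Finset.sum_congr rfl fun j _ => ?_
  by_cases hj : ‖x j‖ = ‖x k‖
  · have : ‖x j‖ ^ r ≠ 0 := (Real.rpow_pos_of_pos (hj ▸ hk0) _).ne'
    rw [mul_right_cancel₀ this (hcol' j (Finset.mem_univ j))]
  · simp [hy, hj, hs.ne']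

end

theorem statement9 {n : ℕ} (A : Matrix (Fin n) (Fin n) ℂ) (p₀ : ℝ≥0∞)
    (hp₀ : 1 < p₀) (hp₀' : p₀ < ⊤)
    (h : opNorm p₀ A = opNorm 1 A ^ p₀.toReal⁻¹ * opNorm ⊤ A ^ (1 - p₀.toReal⁻¹)) :
    LogAffine A := by
  intro p hp
  rcases hp.eq_or_lt with rfl | hp1
  · simp
  by_cases hp' : p = ⊤
  · simp [hp']
  have one_lt_toReal : ∀ q : ℝ≥0∞, 1 < q → q ≠ ⊤ → 1 < q.toReal := fun q hq hq' => by
    simpa using (ENNReal.toReal_lt_toReal ENNReal.one_ne_top hq').2 hq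
  have hr := one_lt_toReal p hp1 hp'
  have hr₀ := one_lt_toReal p₀ hp₀ hp₀'.ne
  have hM0 := opNorm_nonneg ⊤ A
  have hN0 := opNorm_nonneg 1 A
  refine le_antisymm (opNorm_le hp hp' A) ?_
  rcases hM0.eq_or_lt with hM | hM
  · rw [← hM, Real.zero_rpow (sub_pos.2 (inv_lt_one_of_one_lt₀ hr)).ne', mul_zero]
    exact opNorm_nonneg _ _
  have hn : NeZero n := ⟨by
    rintro rfl
    simp [opNorm, lpNorm_top] at hM⟩
  obtain ⟨x, hx1, hx2⟩ := exists_lpNorm_mulVec_eq_opNorm hp₀.le hp₀'.ne A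
  rw [lpNorm_eq_one_iff hp₀.le hp₀'.ne] at hx1
  have hx0 : x ≠ 0 := by
    rintro rfl
    simp [(zero_lt_one.trans hr₀).ne'] at hx1
  have exponent : ∀ s : ℝ, 1 < s → opNorm 1 A ^ s⁻¹ * opNorm ⊤ A ^ (1 - s⁻¹)
      = (opNorm ⊤ A ^ (s - 1) * opNorm 1 A) ^ s⁻¹ := fun s hs => by
    rw [Real.mul_rpow (by positivity) hN0, ← Real.rpow_mul hM0, sub_mul,
      mul_inv_cancel₀ (by positivity), one_mul, mul_comm]
  rw [exponent _ hr₀, ← hx2, lpNorm_of_ne_top hp₀'.ne,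
    Real.rpow_left_inj (by positivity) (by positivity) (by positivity)] at h
  obtain ⟨y, hy0, hy⟩ := exists_forall_sum_norm_mulVec_rpow_eq hr₀ hM
    (sum_norm_row_le_opNorm_top A) (sum_norm_col_le_opNorm_one A) hx0
    (by rw [hx1, mul_one, h])
  rw [exponent _ hr]
  exact rpow_le_opNorm hp hp' hy0 (hy _ (by positivity))
end

section
/- Let B = H(α₀, α₁, …, α_{n−1}) be the n×n matrix whose (i,j) entry (indices 0,…,n−1) is α_k where k ≡ i+j mod n, with α_i ∈ ℂ. Then B is logarithmic affine if and only if there exist β, ω ∈ ℂ with |β| = 1 and ω^n = 1 such that α_i = β ω^i |α_i| for all i = 0,1,…,n−1; and in that case ‖B‖_{p,p} = Σ_{i=0}^{n−1} |α_i| for every p ∈ [1,∞]. -/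
open scoped BigOperators ENNReal
open Matrix

theorem lpNorm_eq_norm_toLp {ι : Type*} [Fintype ι] {p : ℝ≥0∞} [Fact (1 ≤ p)] (x : ι → ℂ) :
    lpNorm p x = ‖WithLp.toLp p x‖ := by
  unfold lpNorm
  split_ifs with h
  · subst h
    rw [PiLp.norm_eq_ciSup]
  · have h1 : (1 : ℝ≥0∞) ≤ p := Fact.out
    rw [PiLp.norm_eq_sum (ENNReal.toReal_pos (by positivity) h), one_div]

theorem lpNorm_comp_equiv {ι : Type*} [Fintype ι] (p : ℝ≥0∞) (x : ι → ℂ) (e : ι ≃ ι) :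
    lpNorm p (fun i => x (e i)) = lpNorm p x := by
  unfold lpNorm
  rw [e.iSup_comp (g := fun i => ‖x i‖), Equiv.sum_comp e (fun i => ‖x i‖ ^ p.toReal)]

theorem toLp_hankelH_mulVec {n : ℕ} [NeZero n] (p : ℝ≥0∞) (α x : Fin n → ℂ) :
    WithLp.toLp p (hankelH α *ᵥ x) = ∑ k, α k • WithLp.toLp p (fun i => x (k - i)) := by
  ext i
  simp only [hankelH, mulVec, dotProduct, of_apply, WithLp.ofLp_sum, WithLp.ofLp_smul,
    Finset.sum_apply, Pi.smul_apply, smul_eq_mul]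
  rw [← Equiv.sum_comp (Equiv.addLeft i) (fun k => α k * x (k - i))]
  simp

theorem norm_toLp_comp_sub {n : ℕ} [NeZero n] (p : ℝ≥0∞) [Fact (1 ≤ p)] (x : Fin n → ℂ)
    (k : Fin n) : ‖WithLp.toLp p (fun i => x (k - i))‖ = ‖WithLp.toLp p x‖ := by
  rw [← lpNorm_eq_norm_toLp, ← lpNorm_eq_norm_toLp]
  exact lpNorm_comp_equiv p x (Equiv.subLeft k)

theorem lpNorm_hankelH_mulVec_le {n : ℕ} [NeZero n] (p : ℝ≥0∞) [Fact (1 ≤ p)]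
    (α x : Fin n → ℂ) :
    lpNorm p (hankelH α *ᵥ x) ≤ (∑ k, ‖α k‖) * lpNorm p x := by
  rw [lpNorm_eq_norm_toLp, lpNorm_eq_norm_toLp, toLp_hankelH_mulVec, Finset.sum_mul]
  refine (norm_sum_le _ _).trans (Finset.sum_le_sum fun k _ => ?_)
  rw [norm_smul, norm_toLp_comp_sub]

theorem opNorm_hankelH_eq_of_le {n : ℕ} [NeZero n] (p : ℝ≥0∞) [Fact (1 ≤ p)]
    (α x : Fin n → ℂ) (hx : lpNorm p x = 1)
    (h : ∑ k, ‖α k‖ ≤ lpNorm p (hankelH α *ᵥ x)) :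
    opNorm p (hankelH α) = ∑ k, ‖α k‖ := by
  have hub : ∀ r ∈ {r : ℝ | ∃ x : Fin n → ℂ, lpNorm p x = 1 ∧
      r = lpNorm p ((hankelH α).mulVec x)}, r ≤ ∑ k, ‖α k‖ := by
    rintro r ⟨y, hy, rfl⟩
    simpa [hy] using lpNorm_hankelH_mulVec_le p α y
  exact le_antisymm (csSup_le ⟨_, x, hx, rfl⟩ hub)
    (h.trans (le_csSup ⟨_, hub⟩ ⟨x, hx, rfl⟩))

theorem opNorm_one_hankelH {n : ℕ} [NeZero n] (α : Fin n → ℂ) :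
    opNorm 1 (hankelH α) = ∑ k, ‖α k‖ := by
  apply opNorm_hankelH_eq_of_le 1 α (Pi.single 0 1)
  · rw [lpNorm_eq_norm_toLp]
    simp
  · simp [lpNorm, hankelH]

theorem opNorm_top_hankelH {n : ℕ} [NeZero n] (α : Fin n → ℂ) :
    opNorm ⊤ (hankelH α) = ∑ k, ‖α k‖ := by
  set x : Fin n → ℂ := fun j => if α j = 0 then 1 else ‖α j‖ / α j with hx
  have hx1 : ∀ j, ‖x j‖ = 1 := by
    intro j
    by_cases h : α j = 0 <;> simp [hx, h]
  have hmul : ∀ j, α j * x j = ‖α j‖ := by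
    intro j
    by_cases h : α j = 0
    · simp [h]
    · simp only [hx, h, if_false]
      field_simp
  apply opNorm_hankelH_eq_of_le ⊤ α x
  · simp [lpNorm, hx1]
  · have h0 : ‖(hankelH α *ᵥ x) 0‖ = ∑ k, ‖α k‖ := by
      simp only [hankelH, mulVec, dotProduct, of_apply, zero_add, hmul]
      rw [← Complex.ofReal_sum, Complex.norm_real, Real.norm_of_nonneg (by positivity)]
    rw [← h0]
    simp only [lpNorm, if_true]
    exact le_ciSup (f := fun i => ‖(hankelH α *ᵥ x) i‖) (Set.finite_range _).bddAbove 0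

theorem logAffine_hankelH_iff {n : ℕ} [NeZero n] (α : Fin n → ℂ) :
    LogAffine (hankelH α) ↔ ∀ p : ℝ≥0∞, 1 ≤ p → opNorm p (hankelH α) = ∑ i, ‖α i‖ := by
  unfold LogAffine
  refine forall₂_congr fun p _ => ?_
  rw [opNorm_one_hankelH, opNorm_top_hankelH, ← Real.rpow_add' (by positivity) (by simp)]
  simp

theorem pow_val_add_of_pow_eq_one {n : ℕ} [NeZero n] {M : Type*} [Monoid M] {ω : M}
    (hω : ω ^ n = 1) (i j : Fin n) :
    ω ^ ((i + j : Fin n) : ℕ) = ω ^ (i : ℕ) * ω ^ (j : ℕ) := by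
  rw [Fin.val_add, ← pow_add]
  exact (pow_eq_pow_mod _ hω).symm

theorem opNorm_hankelH_of_phase {n : ℕ} [NeZero n] (p : ℝ≥0∞) [Fact (1 ≤ p)] {α : Fin n → ℂ}
    {β ω : ℂ} (hβ : ‖β‖ = 1) (hω : ω ^ n = 1)
    (h : ∀ i : Fin n, α i = β * ω ^ (i : ℕ) * (‖α i‖ : ℂ)) :
    opNorm p (hankelH α) = ∑ k, ‖α k‖ := by
  have hω1 : ‖ω‖ = 1 := Complex.norm_eq_one_of_pow_eq_one hω (NeZero.ne n)
  have hω0 : ω ≠ 0 := norm_ne_zero_iff.1 (by simp [hω1])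
  set v : Fin n → ℂ := fun j => (ω ^ (j : ℕ))⁻¹ with hv
  have hv0 : ‖WithLp.toLp p v‖ ≠ 0 := by
    rw [norm_ne_zero_iff]
    intro h0
    have := congrArg (fun w : PiLp p fun _ : Fin n => ℂ => w 0) h0
    simp [hv] at this
  set c : ℂ := ((‖WithLp.toLp p v‖⁻¹ : ℝ) : ℂ) with hc
  have hc1 : lpNorm p (c • v) = 1 := by
    rw [lpNorm_eq_norm_toLp, WithLp.toLp_smul, norm_smul, hc, Complex.norm_real, norm_inv,
      norm_norm, inv_mul_cancel₀ hv0]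
  refine opNorm_hankelH_eq_of_le p α (c • v) hc1 (le_of_eq ?_)
  have hB : ∀ i, ‖(hankelH α *ᵥ (c • v)) i‖ = (∑ k, ‖α k‖) * ‖(c • v) i‖ := by
    intro i
    have : (hankelH α *ᵥ (c • v)) i = c * β * ω ^ (i : ℕ) * ((∑ k, ‖α k‖ : ℝ) : ℂ) := by
      rw [← Equiv.sum_comp (Equiv.addLeft i) (fun k => ‖α k‖)]
      simp only [hankelH, mulVec, dotProduct, of_apply, Equiv.coe_addLeft, Complex.ofReal_sum,
        Finset.mul_sum]
      refine Finset.sum_congr rfl fun j _ => ?_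
      rw [h (i + j), pow_val_add_of_pow_eq_one hω]
      simp only [hv, Pi.smul_apply, smul_eq_mul, norm_mul, norm_pow, hβ, hω1, one_pow, one_mul,
        Complex.norm_real, norm_norm]
      field_simp
    rw [this, norm_mul, norm_mul, norm_mul, Complex.norm_real (∑ k, ‖α k‖),
      Real.norm_of_nonneg (by positivity)]
    simp only [hv, Pi.smul_apply, smul_eq_mul, norm_mul, norm_inv, norm_pow, hβ, hω1, one_pow]
    ring
  calc ∑ k, ‖α k‖ = ‖(((∑ k, ‖α k‖ : ℝ) : ℂ)) • WithLp.toLp p (c • v)‖ := by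
        rw [norm_smul, ← lpNorm_eq_norm_toLp, hc1, mul_one, Complex.norm_real,
          Real.norm_of_nonneg (by positivity)]
    _ = lpNorm p (hankelH α *ᵥ (c • v)) := by
        rw [← WithLp.toLp_smul, ← lpNorm_eq_norm_toLp]
        have : ∀ i, ‖((((∑ k, ‖α k‖ : ℝ) : ℂ)) • (c • v)) i‖ = ‖(hankelH α *ᵥ (c • v)) i‖ := by
          intro i
          rw [hB, Pi.smul_apply, norm_smul, Complex.norm_real, Real.norm_of_nonneg (by positivity)]
        simp only [lpNorm, this]

/-- In a strictly convex space, equality in the triangle inequality for a finite sum forces every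
summand to lie on the ray of the sum. -/
theorem sameRay_sum_of_norm_sum_eq {ι E : Type*} [NormedAddCommGroup E] [NormedSpace ℝ E]
    [StrictConvexSpace ℝ E] {s : Finset ι} {f : ι → E}
    (h : ‖∑ i ∈ s, f i‖ = ∑ i ∈ s, ‖f i‖) {k : ι} (hk : k ∈ s) :
    SameRay ℝ (f k) (∑ i ∈ s, f i) := by
  classical
  rw [← Finset.add_sum_erase s _ hk, ← Finset.add_sum_erase s _ hk] at h
  rw [← Finset.add_sum_erase s _ hk]
  refine (SameRay.refl (f k)).add_right (sameRay_iff_norm_add.2 ?_)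
  refine le_antisymm (norm_add_le _ _) ?_
  rw [h]
  gcongr
  exact norm_sum_le _ _

theorem exists_lpNorm_eq_opNorm {n : ℕ} [NeZero n] (p : ℝ≥0∞) [Fact (1 ≤ p)]
    (A : Matrix (Fin n) (Fin n) ℂ) :
    ∃ x : Fin n → ℂ, lpNorm p x = 1 ∧ lpNorm p (A *ᵥ x) = opNorm p A := by
  obtain ⟨x, hx, hmax⟩ := (isCompact_sphere (0 : PiLp p fun _ : Fin n => ℂ) 1).exists_isMaxOn
    (NormedSpace.sphere_nonempty.2 zero_le_one)
    (f := fun x => ‖WithLp.toLp p (A *ᵥ WithLp.ofLp x)‖)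
    (by
      apply Continuous.continuousOn
      have := PiLp.continuous_toLp p (fun _ : Fin n => ℂ)
      have h2 := PiLp.continuous_ofLp p (fun _ : Fin n => ℂ)
      exact (this.comp (continuous_const.matrix_mulVec h2)).norm)
  have hx1 : lpNorm p (WithLp.ofLp x) = 1 := by
    rw [lpNorm_eq_norm_toLp]
    simpa using hx
  refine ⟨WithLp.ofLp x, hx1, ?_⟩
  have hg : IsGreatest {r : ℝ | ∃ x : Fin n → ℂ, lpNorm p x = 1 ∧ r = lpNorm p (A.mulVec x)}
      (lpNorm p (A *ᵥ WithLp.ofLp x)) := by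
    refine ⟨⟨_, hx1, rfl⟩, ?_⟩
    rintro r ⟨y, hy, rfl⟩
    rw [lpNorm_eq_norm_toLp] at hy ⊢
    rw [lpNorm_eq_norm_toLp]
    exact hmax (a := WithLp.toLp p y) (by simpa using hy)
  exact hg.csSup_eq.symm

theorem exists_pow_eq_one_sum_ne_zero {n : ℕ} [NeZero n] {x : Fin n → ℂ} (hx : x ≠ 0) :
    ∃ ω : ℂ, ω ^ n = 1 ∧ ∑ i : Fin n, ω ^ (i : ℕ) * x i ≠ 0 := by
  have hζ := Complex.isPrimitiveRoot_exp n (NeZero.ne n)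
  set ζ := Complex.exp (2 * Real.pi * Complex.I / n)
  by_contra! hcon
  apply hx
  refine Matrix.eq_zero_of_forall_index_sum_pow_mul_eq_zero (f := fun j : Fin n => ζ ^ (j : ℕ))
    (fun i j hij => Fin.ext (hζ.pow_inj i.2 j.2 hij)) fun j => hcon _ ?_
  rw [← pow_mul, mul_comm, pow_mul, hζ.pow_eq_one, one_pow]

theorem exists_phase_of_opNorm_two_hankelH_eq {n : ℕ} [NeZero n] {α : Fin n → ℂ}
    (h : opNorm 2 (hankelH α) = ∑ k, ‖α k‖) :
    ∃ β ω : ℂ, ‖β‖ = 1 ∧ ω ^ n = 1 ∧ ∀ i : Fin n, α i = β * ω ^ (i : ℕ) * (‖α i‖ : ℂ) := by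
  by_cases hα : ∀ i, α i = 0
  · exact ⟨1, 1, by simp, by simp, by simp [hα]⟩
  push Not at hα
  obtain ⟨m, hm⟩ := hα
  obtain ⟨x, hx, hy⟩ := exists_lpNorm_eq_opNorm 2 (hankelH α)
  rw [h, lpNorm_eq_norm_toLp, toLp_hankelH_mulVec] at hy
  rw [lpNorm_eq_norm_toLp] at hx
  have hn : ∀ k, ‖α k • WithLp.toLp 2 (fun i => x (k - i))‖ = ‖α k‖ := fun k => by
    rw [norm_smul, norm_toLp_comp_sub, hx, mul_one]
  set S : ℝ := ∑ k, ‖α k‖ with hS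
  have hS0 : (S : ℂ) ≠ 0 := by
    rw [Complex.ofReal_ne_zero]
    have : ‖α m‖ ≤ S := Finset.single_le_sum (f := fun k => ‖α k‖) (fun _ _ => norm_nonneg _)
      (Finset.mem_univ m)
    have := norm_pos_iff.2 hm
    linarith
  have hray : ∀ k i, (‖α k‖ : ℂ) * (hankelH α *ᵥ x) i = S * (α k * x (k - i)) := by
    intro k i
    have hs := sameRay_sum_of_norm_sum_eq (s := Finset.univ)
      (f := fun k => α k • WithLp.toLp 2 (fun i => x (k - i)))
      (by rw [hy]; simp only [hn]; rfl) (Finset.mem_univ k)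
    have hs := hs.norm_smul_eq
    rw [hy, hn, ← toLp_hankelH_mulVec] at hs
    simpa using congrArg (fun w : PiLp 2 fun _ : Fin n => ℂ => w i) hs
  have hx0 : x ≠ 0 := by
    rintro rfl
    simp at hx
  obtain ⟨ω, hω, hX⟩ := exists_pow_eq_one_sum_ne_zero hx0
  set X := ∑ i : Fin n, ω ^ (i : ℕ) * x i with hXdef
  have hω1 : ‖ω‖ = 1 := Complex.norm_eq_one_of_pow_eq_one hω (NeZero.ne n)
  have hω0 : ω ≠ 0 := norm_ne_zero_iff.1 (by simp [hω1])
  set Y := ∑ i : Fin n, (ω ^ (i : ℕ))⁻¹ * (hankelH α *ᵥ x) i with hY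
  have key : ∀ k, (‖α k‖ : ℂ) * ω ^ (k : ℕ) * Y = S * α k * X := by
    intro k
    rw [hXdef, hY, ← Equiv.sum_comp (Equiv.subLeft k) (fun i : Fin n => ω ^ (i : ℕ) * x i),
      Finset.mul_sum, Finset.mul_sum]
    refine Finset.sum_congr rfl fun i _ => ?_
    have hp : ω ^ (k : ℕ) = ω ^ ((k - i : Fin n) : ℕ) * ω ^ (i : ℕ) := by
      rw [← pow_val_add_of_pow_eq_one hω, sub_add_cancel]
    have hi : ω ^ (i : ℕ) ≠ 0 := pow_ne_zero _ hω0
    rw [Equiv.subLeft_apply, hp]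
    field_simp
    linear_combination hray k i
  have hrep : ∀ k : Fin n, α k = Y / (S * X) * ω ^ (k : ℕ) * (‖α k‖ : ℂ) := by
    intro k
    field_simp
    linear_combination -key k
  refine ⟨Y / (S * X), ω, ?_, hω, hrep⟩
  have hnorm := congrArg norm (hrep m)
  rw [norm_mul, norm_mul, norm_pow, hω1, one_pow, mul_one, Complex.norm_real, norm_norm] at hnorm
  exact (mul_eq_right₀ (norm_ne_zero_iff.2 hm)).1 hnorm.symm

theorem statement14 {n : ℕ} (hn : 0 < n) (α : Fin n → ℂ) :
    (LogAffine (hankelH α) ↔ ∃ β ω : ℂ, ‖β‖ = 1 ∧ ω ^ n = 1 ∧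
      ∀ i : Fin n, α i = β * ω ^ (i : ℕ) * (‖α i‖ : ℂ)) ∧
    (LogAffine (hankelH α) →
      ∀ p : ℝ≥0∞, 1 ≤ p → opNorm p (hankelH α) = ∑ i, ‖α i‖) := by
  have : NeZero n := ⟨hn.ne'⟩
  rw [logAffine_hankelH_iff]
  refine ⟨⟨fun h => exists_phase_of_opNorm_two_hankelH_eq (h 2 one_le_two), ?_⟩, id⟩
  rintro ⟨β, ω, hβ, hω, h⟩ p hp
  have : Fact (1 ≤ p) := ⟨hp⟩
  exact opNorm_hankelH_of_phase p hβ hω h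
end
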